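/- Let e = R_{e₁,e₀} ∈ so(V, β) (a nilpotent element of Jordan type (3,1⁴)). Then the centralizer of e in so(V, β) equals the ℂ-span of {e, R_{e₂,e₃}, R_{e₂,e₋₃}, R_{e₂,e₋₂}, R_{e₃,e₋₃}, R_{e₃,e₋₂}, R_{e₋₃,e₋₂}, R_{e₁,e₂}, R_{e₁,e₃}, R_{e₁,e₋₃}, R_{e₁,e₋₂}}; in particular it has dimension 11 over ℂ. -/

import Mathlib

noncomputable section

/-- `V = ℂ⁷` with ordered basis `(e₁, e₂, e₃, e₀, e₋₃, e₋₂, e₋₁)`. -/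
abbrev V7 : Type := Fin 7 → ℂ

/-- The Gram matrix of the symmetric bilinear form `β` in the ordered basis
`(e₁, e₂, e₃, e₀, e₋₃, e₋₂, e₋₁)`:  `β(eᵢ, e₋ᵢ) = β(e₋ᵢ, eᵢ) = 1`, `β(e₀,e₀) = 2`,
all other pairs `0`. -/
def Bmat : Matrix (Fin 7) (Fin 7) ℂ :=
  Matrix.of fun i j =>
    if (i : ℕ) + (j : ℕ) = 6 then (if (i : ℕ) = 3 then 2 else 1) else 0

/-- The symmetric bilinear form `β` on `V`. -/
def beta : V7 →ₗ[ℂ] V7 →ₗ[ℂ] ℂ := Matrix.toBilin' Bmat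

/-- `so(V, β) = {x ∈ End(V) : β(xu, w) + β(u, xw) = 0 for all u, w}`. -/
def so7 : Set (Module.End ℂ V7) :=
  {x | ∀ u w : V7, beta (x u) w + beta u (x w) = 0}

/-- `R_{u,w}(v) = β(w,v) • u − β(u,v) • w`. -/
def Rm (u w : V7) : Module.End ℂ V7 :=
  (beta w).smulRight u - (beta u).smulRight w

def e1 : V7 := Pi.single 0 1
def e2 : V7 := Pi.single 1 1
def e3 : V7 := Pi.single 2 1
def e0 : V7 := Pi.single 3 1
def em3 : V7 := Pi.single 4 1
def em2 : V7 := Pi.single 5 1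
def em1 : V7 := Pi.single 6 1

/-- The nilpotent element . -/
def eNil : Module.End ℂ V7 := Rm e1 e0

/-- The centralizer of  in . -/
def cent : Set (Module.End ℂ V7) := {x | x ∈ so7 ∧ x * eNil = eNil * x}

/-- The claimed spanning set. -/
def spanSet : Set (Module.End ℂ V7) := {eNil, Rm e2 e3, Rm e2 em3, Rm e2 em2, Rm e3 em3, Rm e3 em2, Rm em3 em2, Rm e1 e2, Rm e1 e3, Rm e1 em3, Rm e1 em2}

lemma beta_apply (u w : V7) :
    beta u w = u 0 * w 6 + u 1 * w 5 + u 2 * w 4 + 2 * u 3 * w 3 + u 4 * w 2 + u 5 * w 1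
      + u 6 * w 0 := by
  simp [beta, Matrix.toBilin'_apply, Bmat, Fin.sum_univ_seven]
  exact Or.inl (mul_comm _ _)

lemma Rm_apply (u w v : V7) (i : Fin 7) :
    Rm u w v i = beta w v * u i - beta u v * w i := by
  simp [Rm]

/-- The elements of `spanSet` as a family. -/
def spanFamily : Fin 11 → Module.End ℂ V7 :=
  ![eNil, Rm e2 e3, Rm e2 em3, Rm e2 em2, Rm e3 em3, Rm e3 em2, Rm em3 em2, Rm e1 e2, Rm e1 e3,
    Rm e1 em3, Rm e1 em2]

lemma range_spanFamily : Set.range spanFamily = spanSet := by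
  simp only [spanFamily, spanSet, Matrix.range_cons, Matrix.range_empty, Set.singleton_union,
    Set.union_empty]

lemma eNil_apply (v : V7) : eNil v = ![2 * v 3, 0, 0, -v 6, 0, 0, 0] := by
  ext i
  rw [eNil, Rm_apply, beta_apply, beta_apply]
  fin_cases i <;> simp [e1, e0]

lemma sum_spanFamily_apply (c : Fin 11 → ℂ) (v : V7) :
    (∑ k, c k • spanFamily k) v =
      ![2 * c 0 * v 3 + c 7 * v 5 + c 8 * v 4 + c 9 * v 2 + c 10 * v 1,
        c 1 * v 4 + c 2 * v 2 + c 3 * v 1 - c 7 * v 6,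
        -c 1 * v 5 + c 4 * v 2 + c 5 * v 1 - c 8 * v 6,
        -c 0 * v 6,
        -c 2 * v 5 - c 4 * v 4 + c 6 * v 1 - c 9 * v 6,
        -c 3 * v 5 - c 5 * v 4 - c 6 * v 2 - c 10 * v 6,
        0] := by
  have hsum : (∑ k, c k • spanFamily k) = c 0 • eNil + c 1 • Rm e2 e3 + c 2 • Rm e2 em3
      + c 3 • Rm e2 em2 + c 4 • Rm e3 em3 + c 5 • Rm e3 em2 + c 6 • Rm em3 em2 + c 7 • Rm e1 e2
      + c 8 • Rm e1 e3 + c 9 • Rm e1 em3 + c 10 • Rm e1 em2 := by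
    simp only [Fin.sum_univ_succ, Finset.univ_eq_empty, Finset.sum_empty, add_zero, ← add_assoc]
    rfl
  ext i
  simp only [hsum, LinearMap.add_apply, LinearMap.smul_apply, Pi.add_apply, Pi.smul_apply,
    smul_eq_mul, Rm_apply, beta_apply, eNil_apply, e1, e2, e3, em3, em2, Pi.single_apply]
  fin_cases i <;> simp <;> ring

lemma linearIndependent_spanFamily : LinearIndependent ℂ spanFamily := by
  rw [Fintype.linearIndependent_iff]
  intro c hc
  have h (i j : Fin 7) := congrFun ((sum_spanFamily_apply c (Pi.single j 1)).symm.trans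
    (by rw [hc]; rfl : _ = (0 : V7))) i
  have h0 := h 3 6
  have h1 := h 1 4
  have h2 := h 1 2
  have h3 := h 1 1
  have h4 := h 2 2
  have h5 := h 2 1
  have h6 := h 4 1
  have h7 := h 0 5
  have h8 := h 0 4
  have h9 := h 0 2
  have h10 := h 0 1
  simp at h0 h1 h2 h3 h4 h5 h6 h7 h8 h9 h10
  intro k
  fin_cases k <;> assumption

lemma sum_spanFamily_mem_cent (c : Fin 11 → ℂ) : ∑ k, c k • spanFamily k ∈ cent := by
  refine ⟨fun u w => ?_, LinearMap.ext fun v => ?_⟩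
  · rw [beta_apply, beta_apply, sum_spanFamily_apply, sum_spanFamily_apply]
    simp
    ring
  · rw [Module.End.mul_apply, Module.End.mul_apply, sum_spanFamily_apply, eNil_apply, eNil_apply,
      sum_spanFamily_apply]
    ext i
    fin_cases i <;> simp
    ring

set_option maxHeartbeats 2000000 in
lemma eq_sum_of_mem_cent {x : Module.End ℂ V7} (hx : x ∈ cent) :
    ∃ c : Fin 11 → ℂ, ∑ k, c k • spanFamily k = x := by
  obtain ⟨M, hM⟩ : ∃ M : Fin 7 → Fin 7 → ℂ, ∀ i j, x (Pi.single j 1) i = M i j :=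
    ⟨_, fun _ _ => rfl⟩
  have hso (j k : Fin 7) := hx.1 (Pi.single j 1) (Pi.single k 1)
  have hcomm (v : V7) : x (eNil v) = eNil (x v) := LinearMap.congr_fun hx.2 v
  have he0 : eNil (Pi.single 3 1) = (2 : ℂ) • (Pi.single 0 1 : V7) := by
    ext i
    fin_cases i <;> simp [eNil_apply]
  have hem1 : eNil (Pi.single 6 1) = (-1 : ℂ) • (Pi.single 3 1 : V7) := by
    ext i
    fin_cases i <;> simp [eNil_apply]
  have hcol0 (i : Fin 7) := congrFun (hcomm (Pi.single 3 1)) i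
  have hcol3 (i : Fin 7) := congrFun (hcomm (Pi.single 6 1)) i
  rw [he0, map_smul] at hcol0
  rw [hem1, map_smul] at hcol3
  simp only [beta_apply, hM, eNil_apply, Pi.smul_apply, smul_eq_mul] at hso hcol0 hcol3
  refine ⟨![M 0 3 / 2, M 1 4, M 1 2, M 1 1, M 2 2, M 2 1, M 4 1, M 0 5, M 0 4, M 0 2, M 0 1], ?_⟩
  refine (Pi.basisFun ℂ (Fin 7)).ext fun j => ?_
  ext i
  rw [Pi.basisFun_apply, sum_spanFamily_apply, hM]
  have hso33 := hso 3 3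
  have hso0 := hso 0 j
  have hso3 := hso 3 j
  have hsoi := hso (Fin.rev i) j
  have hcol0i := hcol0 i
  have hcol3i := hcol3 i
  have hcol0j := hcol0 (Fin.rev j)
  have hcol3j := hcol3 (Fin.rev j)
  fin_cases j <;> fin_cases i <;>
    simp [Fin.rev] at hso33 hso0 hso3 hsoi hcol0i hcol3i hcol0j hcol3j ⊢ <;>
    grind

theorem statement5 :
    cent = ↑(Submodule.span ℂ spanSet) ∧
      Module.finrank ℂ ↥(Submodule.span ℂ spanSet) = 11 := by
  rw [← range_spanFamily]
  refine ⟨Set.ext fun x => ?_, ?_⟩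
  · rw [SetLike.mem_coe, Submodule.mem_span_range_iff_exists_fun]
    refine ⟨eq_sum_of_mem_cent, ?_⟩
    rintro ⟨c, rfl⟩
    exact sum_spanFamily_mem_cent c
  · simpa using finrank_span_eq_card linearIndependent_spanFamily
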